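/- For fixed ε > 0, let m be the minimal integer with 2 − ε < 2·cos(π/(m+1)), and let v_ε(k) be the maximal number of vertices of a connected k-regular graph X with μ_1(X) ≤ (2−ε)√(k−1). Then there is a constant C depending only on ε such that v_ε(k) ≤ C·(k/√(k−1))^{2m−1} for all sufficiently large k. -/

import Mathlib

open Real

def adjMat {V : Type*} [Fintype V] (G : SimpleGraph V) [DecidableRel G.Adj] :
    Matrix V V ℝ :=
  G.adjMatrix ℝ

def IsAdjEigenvalue {V : Type*} [Fintype V] (G : SimpleGraph V) [DecidableRel G.Adj]
    (μ : ℝ) : Prop :=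
  ∃ v : V → ℝ, v ≠ 0 ∧ (adjMat G).mulVec v = μ • v

/-! ### Chebyshev polynomials of the second kind, rescaled to `[-2, 2]` -/

section Chebyshev

open Polynomial Polynomial.Chebyshev

lemma natDegree_chebyshevS_le (n : ℕ) : (S ℝ n).natDegree ≤ n := by
  induction n using Nat.twoStepInduction with
  | zero => simp
  | one => simp
  | more n ih₀ ih₁ =>
    have h := S_add_two ℝ (n : ℤ)
    push_cast at ih₁ ⊢
    rw [h]
    refine (natDegree_sub_le _ _).trans (max_le ?_ (by omega))
    refine natDegree_mul_le.trans ?_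
    rw [natDegree_X]
    omega

lemma chebyshevS_eval_two_mul_cos (n : ℤ) (φ : ℝ) :
    (S ℝ n).eval (2 * Real.cos φ) * Real.sin φ = Real.sin ((n + 1) * φ) := by
  rw [← U_real_cos, ← S_comp_two_mul_X]
  simp

/-- The kernel polynomial `∑_{j < m} S_j(a) S_j`. -/
noncomputable def chebyshevKernel (a : ℝ) (m : ℕ) : ℝ[X] :=
  ∑ j ∈ Finset.range m, Polynomial.C ((S ℝ j).eval a) * S ℝ j

lemma christoffel_darboux (a : ℝ) (m : ℕ) :
    (X - Polynomial.C a) * chebyshevKernel a m =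
      Polynomial.C ((S ℝ ((m : ℤ) - 1)).eval a) * S ℝ m -
        Polynomial.C ((S ℝ m).eval a) * S ℝ ((m : ℤ) - 1) := by
  induction m with
  | zero => simp [chebyshevKernel]
  | succ m ih =>
    have hs := S_add_one ℝ (m : ℤ)
    rw [chebyshevKernel, Finset.sum_range_succ, mul_add, ← chebyshevKernel, ih]
    push_cast
    rw [add_sub_cancel_right, hs]
    simp only [eval_sub, eval_mul, eval_X, Polynomial.C_sub, Polynomial.C_mul]
    ring

lemma natDegree_chebyshevKernel_succ_le (a : ℝ) (m : ℕ) :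
    (chebyshevKernel a (m + 1)).natDegree ≤ m := by
  refine natDegree_sum_le_of_forall_le _ _ fun j hj => ?_
  have := Finset.mem_range.1 hj
  exact (natDegree_C_mul_le _ _).trans ((natDegree_chebyshevS_le j).trans (by omega))

lemma chebyshevS_eval_pos {m j : ℕ} (hj : j ≤ m) :
    0 < (S ℝ j).eval (2 * Real.cos (π / (m + 2))) := by
  have hm : (0 : ℝ) < m + 2 := by positivity
  have hjm : (j : ℝ) ≤ m := by exact_mod_cast hj
  have hφ : 0 < π / (m + 2) := by positivity
  have hlt : ((j : ℝ) + 1) * (π / (m + 2)) < π := by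
    rw [mul_div_assoc', div_lt_iff₀ hm]
    nlinarith [Real.pi_pos]
  have h1 : 0 < Real.sin (π / (m + 2)) := by
    refine Real.sin_pos_of_pos_of_lt_pi hφ (lt_of_le_of_lt ?_ hlt)
    have : (0 : ℝ) ≤ j := by positivity
    nlinarith
  have h2 : 0 < Real.sin (((j : ℝ) + 1) * (π / (m + 2))) :=
    Real.sin_pos_of_pos_of_lt_pi (by positivity) hlt
  have h := chebyshevS_eval_two_mul_cos (j : ℤ) (π / (m + 2))
  push_cast at h
  rw [← h] at h2
  exact pos_of_mul_pos_left h2 h1.le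

lemma chebyshevS_eval_eq_zero (m : ℕ) :
    (S ℝ ((m : ℤ) + 1)).eval (2 * Real.cos (π / (m + 2))) = 0 := by
  have hm : (0 : ℝ) < m + 2 := by positivity
  have h1 : 0 < Real.sin (π / (m + 2)) := by
    refine Real.sin_pos_of_pos_of_lt_pi (by positivity) ?_
    rw [div_lt_iff₀ hm]
    nlinarith [Real.pi_pos, (Nat.cast_nonneg m : (0 : ℝ) ≤ m)]
  have h := chebyshevS_eval_two_mul_cos ((m : ℤ) + 1) (π / (m + 2))
  have h2 : (((m : ℤ) + 1 : ℤ) + 1 : ℝ) * (π / (m + 2)) = π := by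
    push_cast
    field_simp
    ring
  rw [h2, Real.sin_pi] at h
  exact (mul_eq_zero.1 h).resolve_right h1.ne'

/-- The test polynomial for the linear programming bound. -/
noncomputable def lpPolynomial (a θ : ℝ) (m : ℕ) : ℝ[X] :=
  (X - Polynomial.C θ) * chebyshevKernel a (m + 1) ^ 2

lemma natDegree_lpPolynomial_le (a θ : ℝ) (m : ℕ) :
    (lpPolynomial a θ m).natDegree ≤ 2 * m + 1 := by
  refine natDegree_mul_le.trans ?_
  have h1 : (chebyshevKernel a (m + 1) ^ 2).natDegree ≤ 2 * m :=
    natDegree_pow_le.trans (Nat.mul_le_mul_left 2 (natDegree_chebyshevKernel_succ_le a m))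
  rw [natDegree_X_sub_C]
  omega

lemma lpPolynomial_eq (θ : ℝ) (m : ℕ) :
    lpPolynomial (2 * Real.cos (π / (m + 2))) θ m =
      Polynomial.C ((S ℝ m).eval (2 * Real.cos (π / (m + 2)))) *
          (S ℝ ((m + 1 : ℕ) : ℤ) * chebyshevKernel (2 * Real.cos (π / (m + 2))) (m + 1)) +
        Polynomial.C (2 * Real.cos (π / (m + 2)) - θ) *
          (chebyshevKernel (2 * Real.cos (π / (m + 2))) (m + 1) *
            chebyshevKernel (2 * Real.cos (π / (m + 2))) (m + 1)) := by
  have h := christoffel_darboux (2 * Real.cos (π / (m + 2))) (m + 1)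
  have h0 := chebyshevS_eval_eq_zero m
  push_cast at h ⊢
  rw [h0, add_sub_cancel_right, Polynomial.C_0, zero_mul, sub_zero] at h
  rw [lpPolynomial, ← mul_assoc, ← h, Polynomial.C_sub]
  ring

lemma eval_le_sum_abs_coeff_mul_pow {p : ℝ[X]} {N : ℕ} (hp : p.natDegree ≤ N) {s : ℝ}
    (hs : 1 ≤ s) : p.eval s ≤ (∑ i ∈ Finset.range (N + 1), |p.coeff i|) * s ^ N := by
  rw [eval_eq_sum_range' (Nat.lt_succ_of_le hp), Finset.sum_mul]
  refine Finset.sum_le_sum fun i hi => ?_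
  have hi' : i ≤ N := Nat.lt_succ_iff.1 (Finset.mem_range.1 hi)
  exact mul_le_mul (le_abs_self _) (pow_le_pow_right₀ hs hi') (by positivity) (abs_nonneg _)

end Chebyshev

/-! ### Non-backtracking walks and Chebyshev polynomials of the adjacency matrix -/

section NonBacktracking

variable {V : Type*} [Fintype V] [DecidableEq V] (G : SimpleGraph V) [DecidableRel G.Adj]

/-- The number of non-backtracking walks from `v` to `w` whose first step avoids `u`, of length
at most `i` and of the same parity as `i`. -/
def nbWalk (w : V) : ℕ → V → V → ℝ
  | 0, _, v => if v = w then 1 else 0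
  | i + 1, u, v => (∑ x ∈ (G.neighborFinset v).erase u, nbWalk w i v x) +
      if Odd i ∧ v = w then 1 else 0

/-- The number of non-backtracking walks from `v` to `w` of length at most `i` and of the same
parity as `i`. -/
def nbTotal (w : V) : ℕ → V → ℝ
  | 0, v => if v = w then 1 else 0
  | i + 1, v => (∑ x ∈ G.neighborFinset v, nbWalk G w i v x) + if Odd i ∧ v = w then 1 else 0

lemma nbWalk_nonneg (w : V) (i : ℕ) (u v : V) : 0 ≤ nbWalk G w i u v := by
  induction i generalizing u v with
  | zero => rw [nbWalk]; positivity
  | succ i ih =>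
    rw [nbWalk]
    exact add_nonneg (Finset.sum_nonneg fun x _ => ih v x) (by positivity)

lemma nbTotal_nonneg (w : V) (i : ℕ) (v : V) : 0 ≤ nbTotal G w i v := by
  cases i with
  | zero => rw [nbTotal]; positivity
  | succ i =>
    rw [nbTotal]
    exact add_nonneg (Finset.sum_nonneg fun x _ => nbWalk_nonneg G w i v x) (by positivity)

lemma nbTotal_succ_eq (w : V) (i : ℕ) {u v : V} (h : G.Adj v u) :
    nbTotal G w (i + 1) v = nbWalk G w (i + 1) u v + nbWalk G w i v u := by
  have hu : u ∈ G.neighborFinset v := by simpa using h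
  rw [nbTotal, nbWalk, ← Finset.sum_erase_add _ _ hu]
  ring

lemma sum_nbTotal_succ {k : ℕ} (hk : G.IsRegularOfDegree k) (w : V) (i : ℕ) (v : V) :
    ∑ x ∈ G.neighborFinset v, nbTotal G w (i + 1) x =
      nbTotal G w (i + 2) v + ((k : ℝ) - 1) * nbTotal G w i v := by
  have hcard : ((G.neighborFinset v).card : ℝ) = k := by
    rw [G.card_neighborFinset_eq_degree, hk v]
  have h1 : ∑ x ∈ G.neighborFinset v, nbTotal G w (i + 1) x =
      ∑ x ∈ G.neighborFinset v, nbWalk G w (i + 1) v x +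
        ∑ x ∈ G.neighborFinset v, nbWalk G w i x v := by
    rw [← Finset.sum_add_distrib]
    refine Finset.sum_congr rfl fun x hx => ?_
    have hx' : G.Adj v x := by simpa using hx
    exact nbTotal_succ_eq G w i hx'.symm
  have h2 : ∑ x ∈ G.neighborFinset v, nbWalk G w i x v =
      ((k : ℝ) - 1) * nbTotal G w i v + if Odd (i + 1) ∧ v = w then 1 else 0 := by
    cases i with
    | zero =>
      simp only [nbWalk, nbTotal, Finset.sum_const, nsmul_eq_mul, hcard]
      by_cases hv : v = w <;> simp [hv]
    | succ j =>
      have h3 : ∑ x ∈ G.neighborFinset v, nbWalk G w (j + 1) x v =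
          ∑ x ∈ G.neighborFinset v, (nbTotal G w (j + 1) v - nbWalk G w j v x) := by
        refine Finset.sum_congr rfl fun x hx => ?_
        have hx' : G.Adj v x := by simpa using hx
        rw [nbTotal_succ_eq G w j hx', add_sub_cancel_right]
      have h4 : ∑ x ∈ G.neighborFinset v, nbWalk G w j v x =
          nbTotal G w (j + 1) v - if Odd j ∧ v = w then 1 else 0 := by
        rw [nbTotal, add_sub_cancel_right]
      have h5 : Odd (j + 1 + 1) ↔ Odd j := by grind
      rw [h3, Finset.sum_sub_distrib, h4, Finset.sum_const, nsmul_eq_mul, hcard]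
      simp only [h5]
      ring
  rw [h1, h2, nbTotal]
  ring

open Polynomial Polynomial.Chebyshev in
lemma aeval_chebyshevS_apply {k : ℕ} (hk : G.IsRegularOfDegree k) {r : ℝ} (hr : 0 < r)
    (hrk : r ^ 2 = (k : ℝ) - 1) (i : ℕ) (v w : V) :
    (aeval (r⁻¹ • G.adjMatrix ℝ) (S ℝ i)) v w = nbTotal G w i v / r ^ i := by
  induction i using Nat.twoStepInduction generalizing v with
  | zero => simp [nbTotal, Matrix.one_apply]
  | one =>
    simp [nbTotal, nbWalk, SimpleGraph.adjMatrix_apply, div_eq_inv_mul]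
  | more n ih₀ ih₁ =>
    have h := S_add_two ℝ (n : ℤ)
    push_cast at ih₁ ⊢
    rw [h, map_sub, map_mul, aeval_X, Matrix.sub_apply, ih₀, smul_mul_assoc, Matrix.smul_apply,
      SimpleGraph.adjMatrix_mul_apply]
    simp only [ih₁]
    rw [← Finset.sum_div, sum_nbTotal_succ G hk, ← hrk, smul_eq_mul]
    field_simp
    ring

end NonBacktracking

/-! ### The linear programming bound -/

section LinearProgramming

open Polynomial Polynomial.Chebyshev

lemma Matrix.mul_apply_nonneg {V : Type*} [Fintype V] {M N : Matrix V V ℝ}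
    (hM : ∀ i j, 0 ≤ M i j) (hN : ∀ i j, 0 ≤ N i j) (i j : V) : 0 ≤ (M * N) i j := by
  rw [Matrix.mul_apply]
  exact Finset.sum_nonneg fun x _ => mul_nonneg (hM i x) (hN x j)

variable {V : Type*} [Fintype V] [DecidableEq V]

lemma Matrix.IsHermitian.trace_aeval {M : Matrix V V ℝ} (hM : M.IsHermitian) (p : ℝ[X]) :
    (aeval M p).trace = ∑ i, p.eval (hM.eigenvalues i) := by
  set D : V → ℝ := hM.eigenvalues with hD
  have h1 : M = Unitary.conjStarAlgAut ℝ _ hM.eigenvectorUnitary (Matrix.diagonalAlgHom ℝ D) :=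
    hM.spectral_theorem
  have h2 : aeval M p = Unitary.conjStarAlgAut ℝ _ hM.eigenvectorUnitary
      (Matrix.diagonalAlgHom ℝ (aeval D p)) := by
    conv_lhs => rw [h1]
    rw [aeval_algHom_apply, aeval_algHom_apply]
  rw [h2, Unitary.conjStarAlgAut_apply, Matrix.trace_mul_comm, ← mul_assoc]
  simp [Matrix.trace, aeval_pi]

variable (G : SimpleGraph V) [DecidableRel G.Adj]

lemma mul_card_le_trace_aeval_lpPolynomial {k : ℕ} (hk : G.IsRegularOfDegree k) {r : ℝ}
    (hr : 0 < r) (hrk : r ^ 2 = (k : ℝ) - 1) (m : ℕ) {θ : ℝ}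
    (hθ : θ < 2 * Real.cos (π / (m + 2))) :
    (2 * Real.cos (π / (m + 2)) - θ) * Fintype.card V ≤
      (aeval (r⁻¹ • G.adjMatrix ℝ) (lpPolynomial (2 * Real.cos (π / (m + 2))) θ m)).trace := by
  set a := 2 * Real.cos (π / (m + 2)) with ha
  set B := r⁻¹ • G.adjMatrix ℝ with hB
  have hS : ∀ (j : ℕ) v w, 0 ≤ (aeval B (S ℝ j)) v w := fun j v w => by
    rw [aeval_chebyshevS_apply G hk hr hrk]
    exact div_nonneg (nbTotal_nonneg G w j v) (by positivity)
  have hK : ∀ v w, (1 : Matrix V V ℝ) v w ≤ (aeval B (chebyshevKernel a (m + 1))) v w := by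
    intro v w
    rw [chebyshevKernel, Finset.sum_range_succ', map_add, map_sum, Matrix.add_apply,
      Matrix.sum_apply]
    simp only [Nat.cast_zero, S_zero, eval_one, mul_one, map_one]
    refine le_add_of_nonneg_left (Finset.sum_nonneg fun j hj => ?_)
    rw [map_mul, Polynomial.aeval_C, Algebra.algebraMap_eq_smul_one, smul_mul_assoc, one_mul,
      Matrix.smul_apply, smul_eq_mul]
    exact mul_nonneg (chebyshevS_eval_pos (Finset.mem_range.1 hj)).le (hS _ v w)
  have hK0 : ∀ v w, 0 ≤ (aeval B (chebyshevKernel a (m + 1))) v w := fun v w =>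
    le_trans (by rw [Matrix.one_apply]; positivity) (hK v w)
  have hKK : ∀ v, 1 ≤ (aeval B (chebyshevKernel a (m + 1)) *
      aeval B (chebyshevKernel a (m + 1))) v v := by
    intro v
    have h1 : 1 ≤ (aeval B (chebyshevKernel a (m + 1))) v v := by simpa using hK v v
    rw [Matrix.mul_apply]
    refine (one_le_mul_of_one_le_of_one_le h1 h1).trans ?_
    exact Finset.single_le_sum
      (f := fun x => (aeval B (chebyshevKernel a (m + 1))) v x *
        (aeval B (chebyshevKernel a (m + 1))) x v)
      (fun x _ => mul_nonneg (hK0 v x) (hK0 x v)) (Finset.mem_univ v)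
  have hcard : (a - θ) * Fintype.card V = ∑ _v : V, (a - θ) := by
    simp [nsmul_eq_mul, mul_comm, mul_sub]
  rw [hcard, Matrix.trace]
  refine Finset.sum_le_sum fun v _ => ?_
  rw [Matrix.diag_apply, lpPolynomial_eq]
  simp only [map_add, map_mul, Polynomial.aeval_C, Algebra.algebraMap_eq_smul_one, smul_mul_assoc,
    one_mul, Matrix.smul_apply, Matrix.add_apply, smul_eq_mul]
  have h1 := mul_nonneg (chebyshevS_eval_pos le_rfl : 0 < (S ℝ m).eval a).le
    (Matrix.mul_apply_nonneg (hS (m + 1)) hK0 v v)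
  have h2 := mul_le_mul_of_nonneg_left (hKK v) (sub_pos.2 hθ).le
  simp only [← ha]
  linarith

lemma eq_const_of_adjMatrix_mulVec_eq {k : ℕ} (hk : G.IsRegularOfDegree k) (hG : G.Connected)
    {x : V → ℝ} (hx : (G.adjMatrix ℝ).mulVec x = (k : ℝ) • x) (u v : V) : x u = x v := by
  have h : (G.lapMatrix ℝ).mulVec x = 0 := by
    ext i
    rw [SimpleGraph.lapMatrix_mulVec_apply, ← SimpleGraph.adjMatrix_mulVec_apply, hx, hk i]
    simp
  exact (G.lapMatrix_mulVec_eq_zero_iff_forall_reachable.1 h) u v (hG.preconnected u v)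

lemma trace_aeval_le_eval {k : ℕ} (hk : G.IsRegularOfDegree k) (hG : G.Connected) {r θ : ℝ}
    (hr : 0 < r) (hμ : ∀ μ : ℝ, IsAdjEigenvalue G μ → μ = k ∨ μ ≤ θ * r) {p : ℝ[X]}
    (hp : ∀ x ≤ θ, p.eval x ≤ 0) (hpk : 0 ≤ p.eval (k / r)) :
    (aeval (r⁻¹ • G.adjMatrix ℝ) p).trace ≤ p.eval (k / r) := by
  have hB : (r⁻¹ • G.adjMatrix ℝ).IsHermitian := by
    refine Matrix.IsHermitian.ext fun i j => ?_
    simp [SimpleGraph.adjMatrix_apply, G.adj_comm]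
  rw [hB.trace_aeval]
  have hvec : ∀ i, (G.adjMatrix ℝ).mulVec (hB.eigenvectorBasis i).ofLp =
      (hB.eigenvalues i * r) • (hB.eigenvectorBasis i).ofLp := by
    intro i
    have h := hB.mulVec_eigenvectorBasis i
    rw [Matrix.smul_mulVec, inv_smul_eq_iff₀ hr.ne'] at h
    rw [h, smul_smul, mul_comm]
  have hne : ∀ i, (hB.eigenvectorBasis i).ofLp ≠ 0 := fun i =>
    (WithLp.ofLp_eq_zero 2).ne.2 (hB.eigenvectorBasis.orthonormal.ne_zero i)
  have hcase : ∀ i, hB.eigenvalues i = k / r ∨ p.eval (hB.eigenvalues i) ≤ 0 := by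
    intro i
    rcases hμ _ ⟨_, hne i, hvec i⟩ with h | h
    · left
      rw [eq_div_iff hr.ne', h]
    · right
      exact hp _ (le_of_mul_le_mul_right h hr)
  have huniq : ∀ i j, hB.eigenvalues i = k / r → hB.eigenvalues j = k / r → i = j := by
    intro i j hi hj
    by_contra hij
    have hc : ∀ i, hB.eigenvalues i = k / r → ∀ u v,
        (hB.eigenvectorBasis i).ofLp u = (hB.eigenvectorBasis i).ofLp v := by
      intro i hi
      refine eq_const_of_adjMatrix_mulVec_eq G hk hG ?_
      rw [hvec i, hi, div_mul_cancel₀ _ hr.ne']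
    obtain ⟨u, hu⟩ := Function.ne_iff.1 (hne i)
    obtain ⟨v, hv⟩ := Function.ne_iff.1 (hne j)
    have h0 : inner ℝ (hB.eigenvectorBasis i) (hB.eigenvectorBasis j) = 0 :=
      hB.eigenvectorBasis.orthonormal.2 hij
    rw [PiLp.inner_apply] at h0
    have h1 : ∀ x, inner ℝ ((hB.eigenvectorBasis i).ofLp x) ((hB.eigenvectorBasis j).ofLp x) =
        (hB.eigenvectorBasis i).ofLp u * (hB.eigenvectorBasis j).ofLp v := by
      intro x
      rw [hc i hi x u, hc j hj x v]
      simp [mul_comm]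
    simp only [h1, Finset.sum_const, Finset.card_univ, nsmul_eq_mul] at h0
    have : Nonempty V := ⟨u⟩
    have hV : (Fintype.card V : ℝ) ≠ 0 := by exact_mod_cast Fintype.card_ne_zero
    exact mul_ne_zero hV (mul_ne_zero hu hv) h0
  by_cases hex : ∃ i, hB.eigenvalues i = k / r
  · obtain ⟨i, hi⟩ := hex
    rw [← Finset.add_sum_erase _ _ (Finset.mem_univ i), hi]
    refine add_le_of_nonpos_right (Finset.sum_nonpos fun j hj => ?_)
    exact (hcase j).resolve_left fun h => (Finset.ne_of_mem_erase hj) (huniq j i h hi)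
  · push Not at hex
    exact (Finset.sum_nonpos fun j _ => (hcase j).resolve_left (hex j)).trans hpk

theorem exists_card_le_mul_pow (m : ℕ) {θ : ℝ} (hθ : θ < 2 * Real.cos (π / (m + 2))) :
    ∃ C : ℝ, 0 < C ∧ ∀ k : ℕ, 2 ≤ k →
      ∀ (n : ℕ) (G : SimpleGraph (Fin n)) (_ : DecidableRel G.Adj),
        G.Connected → G.IsRegularOfDegree k →
        (∀ μ : ℝ, IsAdjEigenvalue G μ → μ = k ∨ μ ≤ θ * Real.sqrt (k - 1)) →
        (n : ℝ) ≤ C * ((k : ℝ) / Real.sqrt (k - 1)) ^ (2 * m + 1) := by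
  set a := 2 * Real.cos (π / (m + 2)) with ha
  set p := lpPolynomial a θ m with hpdef
  have hpos : 0 < a - θ := sub_pos.2 hθ
  set c := ∑ i ∈ Finset.range (2 * m + 1 + 1), |p.coeff i| with hc
  have hc0 : 0 ≤ c := Finset.sum_nonneg fun i _ => abs_nonneg _
  refine ⟨(c + 1) / (a - θ), by positivity, fun k hk n G _ hG hreg hμ => ?_⟩
  have hk' : (2 : ℝ) ≤ k := by exact_mod_cast hk
  have hr : 0 < √((k : ℝ) - 1) := Real.sqrt_pos.2 (by linarith)
  have hrk : √((k : ℝ) - 1) ^ 2 = (k : ℝ) - 1 := Real.sq_sqrt (by linarith)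
  set r := √((k : ℝ) - 1)
  have hs : 2 ≤ (k : ℝ) / r := by
    rw [le_div_iff₀ hr]
    nlinarith [sq_nonneg (r - 1)]
  have hθs : θ ≤ (k : ℝ) / r := by
    have := Real.cos_le_one (π / (m + 2))
    linarith
  have hp : ∀ x ≤ θ, p.eval x ≤ 0 := fun x hx => by
    simp only [hpdef, lpPolynomial, eval_mul, eval_sub, eval_X, eval_C, eval_pow]
    exact mul_nonpos_of_nonpos_of_nonneg (sub_nonpos.2 hx) (sq_nonneg _)
  have hpk : 0 ≤ p.eval ((k : ℝ) / r) := by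
    simp only [hpdef, lpPolynomial, eval_mul, eval_sub, eval_X, eval_C, eval_pow]
    exact mul_nonneg (sub_nonneg.2 hθs) (sq_nonneg _)
  have h1 := mul_card_le_trace_aeval_lpPolynomial G hreg hr hrk m hθ
  have h2 := trace_aeval_le_eval G hreg hG hr hμ hp hpk
  have h3 := eval_le_sum_abs_coeff_mul_pow (natDegree_lpPolynomial_le a θ m)
    (one_le_two.trans hs)
  rw [Fintype.card_fin] at h1
  rw [div_mul_eq_mul_div, le_div_iff₀ hpos, mul_comm]
  have h4 : 0 ≤ ((k : ℝ) / r) ^ (2 * m + 1) := by positivity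
  calc (a - θ) * n ≤ c * ((k : ℝ) / r) ^ (2 * m + 1) := h1.trans (h2.trans h3)
    _ ≤ (c + 1) * ((k : ℝ) / r) ^ (2 * m + 1) := by gcongr; linarith

end LinearProgramming

/-- Fix `ε > 0` and let `m` be the minimal integer with `2 - ε < 2 cos (π/(m+1))`.
Then there is a constant `C` depending only on `ε` such that, for all sufficiently
large `k`, every connected `k`-regular graph `X` with
`μ₁(X) ≤ (2 - ε)√(k-1)` has at most `C (k/√(k-1))^{2m-1}` vertices. -/
theorem asymptotic_vertex_bound (ε : ℝ) (hε : 0 < ε) (m : ℕ)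
    (hm : 2 - ε < 2 * Real.cos (π / (m + 1)))
    (hmin : ∀ m' : ℕ, m' < m → ¬(2 - ε < 2 * Real.cos (π / (m' + 1)))) :
    ∃ C : ℝ, 0 < C ∧ ∃ K : ℕ, ∀ k : ℕ, K ≤ k →
      ∀ (n : ℕ) (G : SimpleGraph (Fin n)) (_ : DecidableRel G.Adj),
        G.Connected → G.IsRegularOfDegree k →
        (∀ μ : ℝ, IsAdjEigenvalue G μ → μ = k ∨ μ ≤ (2 - ε) * Real.sqrt (k - 1)) →
        (n : ℝ) ≤ C * ((k : ℝ) / Real.sqrt (k - 1)) ^ (2 * m - 1) := by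
  cases m with
  | zero =>
    have hθ : 2 - ε < 2 * Real.cos (π / ((0 : ℕ) + 2)) := by
      norm_num at hm ⊢
      linarith
    obtain ⟨C, hC, h⟩ := exists_card_le_mul_pow 0 hθ
    refine ⟨1, one_pos, ⌈C ^ 2⌉₊ + 2, fun k hk n G _ hG hreg hμ => ?_⟩
    have hn := h k (by omega) n G _ hG hreg hμ
    have hkn : k < n := by
      obtain ⟨v⟩ := hG.nonempty
      simpa [hreg v] using G.degree_lt_card_verts v
    have hkn' : (k : ℝ) < n := by exact_mod_cast hkn
    have hk1 : C ^ 2 + 2 ≤ (k : ℝ) := by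
      have h1 : ((⌈C ^ 2⌉₊ + 2 : ℕ) : ℝ) ≤ k := by exact_mod_cast hk
      push_cast at h1
      linarith [Nat.le_ceil (C ^ 2)]
    have hCr : C < √((k : ℝ) - 1) := Real.lt_sqrt_of_sq_lt (by linarith)
    have hk0 : (0 : ℝ) < k := by nlinarith
    have hlt : C * ((k : ℝ) / √((k : ℝ) - 1)) < k := by
      rw [mul_div_assoc', div_lt_iff₀ (hC.trans hCr), mul_comm]
      exact mul_lt_mul_of_pos_left hCr hk0
    rw [mul_zero, zero_add, pow_one] at hn
    linarith
  | succ m =>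
    have hθ : 2 - ε < 2 * Real.cos (π / (m + 2)) := by
      push_cast at hm
      rwa [add_assoc, one_add_one_eq_two] at hm
    obtain ⟨C, hC, h⟩ := exists_card_le_mul_pow m hθ
    exact ⟨C, hC, 2, h⟩
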